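/- Let K = {0}, so Ω = ℝ^d \ {0}, d_Γ(x) = |x| and d_H = 0, and let δ = δ' ∈ [0,2), so c_Ω(x) = |x|^δ. Then for every p > 1 with d + pδ − 2p > 0, the optimal Rellich constant equals ν_p(Ω) = ((p−1)·d·(d + pδ − 2p)/p²)^p; that is, the infimum over nonzero φ ∈ C_c^2(Ω) of (∫_Ω |Hφ|^p)/(∫_Ω |x|^{(δ−2)p} |φ|^p) equals ((p−1)·d·(d + pδ − 2p)/p²)^p. -/

import Mathlib

open MeasureTheory Set
open scoped RealInnerProductSpace

noncomputable section

/-- The Laplacian `Δφ = Σ_k ∂_k² φ`. -/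
def lapl {d : ℕ} (φ : EuclideanSpace ℝ (Fin d) → ℝ) (x : EuclideanSpace ℝ (Fin d)) : ℝ :=
  ∑ i, iteratedFDeriv ℝ 2 φ x (fun _ => EuclideanSpace.single i (1 : ℝ))

/-- The weighted operator `H = -div(|x|^δ ∇)` on `ℝ^d \ {0}`. -/
def Hop {d : ℕ} (δ : ℝ) (φ : EuclideanSpace ℝ (Fin d) → ℝ)
    (x : EuclideanSpace ℝ (Fin d)) : ℝ :=
  -(‖x‖ ^ δ) * lapl φ x - ⟪gradient (fun y => ‖y‖ ^ δ) x, gradient φ x⟫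

open Filter Topology

abbrev EE (d : ℕ) := EuclideanSpace ℝ (Fin d)

/-- i-th partial derivative -/
def pd {d : ℕ} (i : Fin d) (φ : EE d → ℝ) (x : EE d) : ℝ :=
  fderiv ℝ φ x (EuclideanSpace.single i (1 : ℝ))

lemma hasFDerivAt_npow {d : ℕ} (m : ℝ) {x : EE d} (hx : x ≠ 0) :
    HasFDerivAt (fun y : EE d => ‖y‖ ^ m) ((m * ‖x‖ ^ (m - 2)) • innerSL ℝ x) x := by
  have hn : 0 < ‖x‖ := norm_pos_iff.mpr hx
  have h1 : HasFDerivAt (fun y : EE d => ‖y‖ ^ 2) (2 • innerSL ℝ x) x :=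
    (hasStrictFDerivAt_norm_sq x).hasFDerivAt
  have h2 := h1.rpow_const (p := m / 2) (Or.inl (by positivity))
  have h3 : (fun y : EE d => (‖y‖ ^ 2) ^ (m / 2)) = fun y : EE d => ‖y‖ ^ m := by
    funext y
    rw [← Real.rpow_natCast, ← Real.rpow_mul (norm_nonneg y)]
    congr 1; push_cast; ring
  rw [h3] at h2
  refine h2.congr_fderiv (ContinuousLinearMap.ext fun v => ?_)
  simp only [_root_.smul_apply, smul_eq_mul, innerSL_apply_apply, nsmul_eq_mul]
  rw [← Real.rpow_natCast, ← Real.rpow_mul (norm_nonneg x)]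
  have : ((2 : ℕ) : ℝ) * (m / 2 - 1) = m - 2 := by push_cast; ring
  rw [this]
  push_cast
  ring

lemma inner_single' {d : ℕ} (x : EE d) (i : Fin d) :
    inner ℝ x (EuclideanSpace.single i (1 : ℝ)) = x i := by
  simp [EuclideanSpace.inner_single_right]

lemma sum_sq {d : ℕ} (x : EE d) : ∑ i, x i ^ 2 = ‖x‖ ^ 2 := by
  rw [EuclideanSpace.norm_sq_eq]; simp

lemma fderiv_self_eq {d : ℕ} (φ : EE d → ℝ) (x y : EE d) :
    fderiv ℝ φ x y = ∑ i, y i * pd i φ x := by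
  conv_lhs => rw [← (EuclideanSpace.basisFun (Fin d) ℝ).sum_repr y]
  simp [pd]

lemma lapl_eq {d : ℕ} {φ : EE d → ℝ} {x : EE d} (h : DifferentiableAt ℝ (fderiv ℝ φ) x) :
    lapl φ x = ∑ i, pd i (pd i φ) x := by
  unfold lapl
  refine Finset.sum_congr rfl fun i _ => ?_
  rw [iteratedFDeriv_two_apply]
  unfold pd
  have := h.hasFDerivAt.clm_apply (hasFDerivAt_const (EuclideanSpace.single i (1:ℝ)) x)
  rw [this.fderiv]
  simp

lemma Hop_eq {d : ℕ} (δ : ℝ) {φ : EE d → ℝ} {x : EE d} (hx : x ≠ 0)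
    (h : DifferentiableAt ℝ (fderiv ℝ φ) x) :
    Hop δ φ x = - ‖x‖ ^ δ * ∑ i, pd i (pd i φ) x
      - δ * ‖x‖ ^ (δ - 2) * ∑ i, x i * pd i φ x := by
  unfold Hop
  rw [lapl_eq h, inner_gradient_left, (hasFDerivAt_npow δ hx).fderiv]
  simp only [_root_.smul_apply, smul_eq_mul, innerSL_apply_apply]
  rw [inner_gradient_right, fderiv_self_eq]
  simp

lemma pd_zero_of {d : ℕ} {φ : EE d → ℝ} {i : Fin d} {x : EE d} (hx : x ∉ tsupport φ) :
    pd i φ x = 0 := by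
  unfold pd
  have : fderiv ℝ φ x = 0 := by
    by_contra h
    exact hx (support_fderiv_subset ℝ h)
  simp [this]

lemma tsupport_pd {d : ℕ} {φ : EE d → ℝ} {i : Fin d} : tsupport (pd i φ) ⊆ tsupport φ := by
  apply closure_minimal _ (isClosed_tsupport φ)
  intro x hx
  by_contra h
  exact hx (pd_zero_of h)

lemma Hop_zero_of {d : ℕ} {δ : ℝ} {φ : EE d → ℝ} (h : ContDiff ℝ 2 φ) {x : EE d}
    (hx : x ∉ tsupport φ) : Hop δ φ x = 0 := by
  unfold Hop
  have h2 : DifferentiableAt ℝ (fderiv ℝ φ) x :=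
    ((h.fderiv_right (m := 1) (by norm_num)).differentiable (by norm_num)) x
  have h1 : fderiv ℝ φ x = 0 := by
    by_contra h
    exact hx (support_fderiv_subset ℝ h)
  rw [lapl_eq h2, Finset.sum_eq_zero fun i _ => pd_zero_of (fun h => hx (tsupport_pd h)),
    inner_gradient_right, h1]
  simp

/-- generic gluing -/
lemma glue_cont {d : ℕ} {K : Set (EE d)} (hK : IsClosed K) (h0 : (0 : EE d) ∉ K) {F : EE d → ℝ}
    (hF : ∀ x, x ∉ K → F x = 0) (hc : ∀ x, x ≠ 0 → ContinuousAt F x) : Continuous F := by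
  rw [continuous_iff_continuousAt]
  intro x
  by_cases hx : x = 0
  · subst hx
    have : F =ᶠ[𝓝 0] fun _ => 0 := by
      filter_upwards [hK.isOpen_compl.mem_nhds h0] with y hy using hF y hy
    exact continuousAt_const.congr this.symm
  · exact hc x hx

lemma glue_int {d : ℕ} {K : Set (EE d)} (hK : IsCompact K) {F : EE d → ℝ}
    (hF : ∀ x, x ∉ K → F x = 0) (hc : Continuous F) : Integrable F :=
  hc.integrable_of_hasCompactSupport (HasCompactSupport.intro hK hF)

lemma int_pd_zero {d : ℕ} {K : Set (EE d)} (hK : IsCompact K) {V : EE d → ℝ} (i : Fin d)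
    (hF : ∀ x, x ∉ K → V x = 0) (hc : ContDiff ℝ 1 V) :
    Integrable (pd i V) ∧ ∫ x, pd i V x = 0 := by
  have hs : tsupport V ⊆ K := closure_minimal (fun x hx => by
    by_contra h; exact hx (hF x h)) hK.isClosed
  have hcp : Continuous (pd i V) := (hc.continuous_fderiv (by norm_num)).clm_apply continuous_const
  have h1 : Integrable (pd i V) := glue_int hK (fun x hx => pd_zero_of fun h => hx (hs h)) hcp
  refine ⟨h1, ?_⟩
  have h2 : Integrable V := glue_int hK hF hc.continuous
  have := integral_mul_fderiv_eq_neg_fderiv_mul_of_integrable (μ := (volume : Measure (EE d)))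
    (f := fun _ => (1:ℝ)) (g := V) (v := EuclideanSpace.single i (1:ℝ))
    (by simp) (by simp only [one_mul]; exact h1) (by simpa using h2) (by intro x _; fun_prop)
      (by intro x _; exact hc.differentiable (by norm_num) x)
  simpa [pd] using this
def gg (p e t : ℝ) : ℝ := t * (t ^ 2 + e) ^ (p / 2 - 1)
def gg' (p e t : ℝ) : ℝ := (t ^ 2 + e) ^ (p / 2 - 2) * ((p - 1) * t ^ 2 + e)
def GG (p e t : ℝ) : ℝ := (t ^ 2 + e) ^ (p / 2) - e ^ (p / 2)
def RR (p e t : ℝ) : ℝ := t ^ 2 * (t ^ 2 + e) ^ (p / 2) / ((p - 1) * t ^ 2 + e)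

lemma contDiff_gg (p : ℝ) {e : ℝ} (he : 0 < e) : ContDiff ℝ 2 (gg p e) := by
  unfold gg
  refine contDiff_id.mul (ContDiff.rpow_const_of_ne (by fun_prop) fun x => ?_)
  positivity

lemma contDiff_GG (p : ℝ) {e : ℝ} (he : 0 < e) : ContDiff ℝ 2 (GG p e) := by
  unfold GG
  refine (ContDiff.rpow_const_of_ne (by fun_prop) fun x => ?_).sub contDiff_const
  positivity

lemma cont_RR {p : ℝ} (hp : 1 < p) {e : ℝ} (he : 0 < e) : Continuous (RR p e) := by
  unfold RR
  refine Continuous.div ?_ (by fun_prop) fun x => ?_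
  · refine (by fun_prop : Continuous fun t : ℝ => t ^ 2).mul
      (Continuous.rpow_const (by fun_prop) fun x => Or.inl (by positivity))
  · have : 0 ≤ p - 1 := by linarith
    positivity

lemma u_split (p : ℝ) {u : ℝ} (hu : 0 < u) :
    u ^ (p / 2 - 1) = u ^ (p / 2 - 2) * u ∧ u ^ (p / 2) = u ^ (p / 2 - 2) * u ^ 2 := by
  constructor
  · rw [← Real.rpow_add_one hu.ne']; congr 1; ring
  · rw [← Real.rpow_natCast, ← Real.rpow_add hu]; congr 1; push_cast; ring

lemma hasDerivAt_gg (p : ℝ) {e : ℝ} (he : 0 < e) (t : ℝ) :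
    HasDerivAt (gg p e) (gg' p e t) t := by
  have hu : 0 < t ^ 2 + e := by positivity
  have h1 : HasDerivAt (fun t : ℝ => t ^ 2 + e) (2 * t) t := by
    simpa using (hasDerivAt_pow 2 t).add_const e
  have h2 := (hasDerivAt_id t).mul (h1.rpow_const (p := p / 2 - 1) (Or.inl hu.ne'))
  refine h2.congr_deriv ?_
  unfold gg'
  have h3 : p / 2 - 1 - 1 = p / 2 - 2 := by ring
  rw [h3, (u_split p hu).1]
  simp only [id]
  ring

lemma hasDerivAt_GG (p : ℝ) {e : ℝ} (he : 0 < e) (t : ℝ) :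
    HasDerivAt (GG p e) (p * gg p e t) t := by
  have hu : 0 < t ^ 2 + e := by positivity
  have h1 : HasDerivAt (fun t : ℝ => t ^ 2 + e) (2 * t) t := by
    simpa using (hasDerivAt_pow 2 t).add_const e
  have h2 := (h1.rpow_const (p := p / 2) (Or.inl hu.ne')).sub_const (e ^ (p / 2))
  refine h2.congr_deriv ?_
  unfold gg
  ring

lemma quad_ineq {p e : ℝ} (hp : 1 < p) (he : 0 < e) (t κ D X : ℝ) {r : ℝ} (hr : 0 < r) (s : ℝ) :
    0 ≤ r ^ s * gg' p e t * D ^ 2 + κ * r ^ (s - 2) * gg p e t * X * D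
      + κ ^ 2 / 4 * r ^ (s - 4) * RR p e t * X ^ 2 := by
  have hu : 0 < t ^ 2 + e := by positivity
  have hA : 0 < (p - 1) * t ^ 2 + e := by
    have : 0 ≤ p - 1 := by linarith
    positivity
  have e1 : r ^ s = r ^ (s - 4) * r ^ 4 := by
    rw [← Real.rpow_natCast, ← Real.rpow_add hr]; congr 1; push_cast; ring
  have e2 : r ^ (s - 2) = r ^ (s - 4) * r ^ 2 := by
    rw [← Real.rpow_natCast, ← Real.rpow_add hr]; congr 1; push_cast; ring
  unfold gg gg' RR
  rw [e1, e2, (u_split p hu).1, (u_split p hu).2]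
  generalize (t ^ 2 + e) ^ (p / 2 - 2) = m, h : (t ^ 2 + e) ^ (p / 2 - 2) = m
  have hm : 0 < m := h ▸ Real.rpow_pos_of_pos hu _
  have hq : 0 < r ^ (s - 4) := Real.rpow_pos_of_pos hr _
  generalize r ^ (s - 4) = q at *
  generalize (p - 1) * t ^ 2 + e = A at *
  have : q * r ^ 4 * (m * A) * D ^ 2 + κ * (q * r ^ 2) * (t * (m * (t ^ 2 + e))) * X * D +
      κ ^ 2 / 4 * q * (t ^ 2 * (m * (t ^ 2 + e) ^ 2) / A) * X ^ 2
      = m / A * q * (r ^ 2 * A * D + κ / 2 * t * (t ^ 2 + e) * X) ^ 2 := by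
    field_simp
    ring
  rw [this]
  positivity

def Vf {d : ℕ} (β s p e : ℝ) (φ : EE d → ℝ) (i : Fin d) (x : EE d) : ℝ :=
  ‖x‖ ^ s * (gg p e (φ x) * pd i φ x) + β * (‖x‖ ^ (s - 2) * (x i * GG p e (φ x)))

lemma contDiff_pd {d : ℕ} {φ : EE d → ℝ} (h : ContDiff ℝ 2 φ) (i : Fin d) :
    ContDiff ℝ 1 (pd i φ) :=
  (h.fderiv_right (m := 1) (by norm_num)).clm_apply contDiff_const

lemma pd_Vf {d : ℕ} (β s p : ℝ) {e : ℝ} (he : 0 < e) {φ : EE d → ℝ} (h : ContDiff ℝ 2 φ)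
    (i : Fin d) {x : EE d} (hx : x ≠ 0) :
    pd i (Vf β s p e φ i) x =
      s * ‖x‖ ^ (s - 2) * x i * gg p e (φ x) * pd i φ x
      + ‖x‖ ^ s * gg' p e (φ x) * pd i φ x ^ 2
      + ‖x‖ ^ s * gg p e (φ x) * pd i (pd i φ) x
      + β * (s - 2) * ‖x‖ ^ (s - 4) * x i ^ 2 * GG p e (φ x)
      + β * ‖x‖ ^ (s - 2) * GG p e (φ x)
      + β * ‖x‖ ^ (s - 2) * x i * p * gg p e (φ x) * pd i φ x := by
  have hφ : HasFDerivAt φ (fderiv ℝ φ x) x := (h.differentiable (by norm_num) x).hasFDerivAt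
  have hD : HasFDerivAt (pd i φ) (fderiv ℝ (pd i φ) x) x :=
    ((contDiff_pd h i).differentiable (by norm_num) x).hasFDerivAt
  have hg := (hasDerivAt_gg p he (φ x)).comp_hasFDerivAt x hφ
  have hG := (hasDerivAt_GG p he (φ x)).comp_hasFDerivAt x hφ
  have hxi : HasFDerivAt (fun y : EE d => y i) (EuclideanSpace.proj (𝕜 := ℝ) i) x :=
    (EuclideanSpace.proj (𝕜 := ℝ) i).hasFDerivAt
  have hV := ((hasFDerivAt_npow s hx).mul (hg.mul hD)).add
    (((hasFDerivAt_npow (s - 2) hx).mul (hxi.mul hG)).const_mul β)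
  have hV' : HasFDerivAt (Vf β s p e φ i) _ x := hV
  have hp1 : EuclideanSpace.proj (𝕜 := ℝ) i (EuclideanSpace.single i (1 : ℝ)) = (1 : ℝ) := by simp
  have e4 : s - 2 - 2 = s - 4 := by ring
  unfold pd at *
  rw [hV'.fderiv]
  simp only [_root_.add_apply, _root_.smul_apply, smul_eq_mul, innerSL_apply_apply, inner_single',
    Function.comp, e4, hp1, Pi.mul_apply]
  ring

lemma pointwise_ineq {d : ℕ} {p e : ℝ} (hp : 1 < p) (he : 0 < e) (β s δ : ℝ)
    {φ : EE d → ℝ} (h : ContDiff ℝ 2 φ) {x : EE d} (hx : x ≠ 0) :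
    0 ≤ ∑ i, pd i (Vf β s p e φ i) x + (‖x‖ ^ (s - δ) * (gg p e (φ x) * Hop δ φ x)
      - β * (d + s - 2) * (‖x‖ ^ (s - 2) * GG p e (φ x))
      + (s - δ + β * p) ^ 2 / 4 * (‖x‖ ^ (s - 2) * RR p e (φ x))) := by
  have hr : 0 < ‖x‖ := norm_pos_iff.mpr hx
  have h2 : DifferentiableAt ℝ (fderiv ℝ φ) x :=
    ((h.fderiv_right (m := 1) (by norm_num)).differentiable (by norm_num)) x
  rw [Hop_eq δ hx h2]
  have hsum := Finset.sum_nonneg (s := Finset.univ) (fun (i : Fin d) _ =>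
    quad_ineq hp he (φ x) (s - δ + β * p) (pd i φ x) (x i) hr s)
  have e1 : ‖x‖ ^ (s - δ) * ‖x‖ ^ δ = ‖x‖ ^ s := by rw [← Real.rpow_add hr]; congr 1; ring
  have e2 : ‖x‖ ^ (s - δ) * ‖x‖ ^ (δ - 2) = ‖x‖ ^ (s - 2) := by
    rw [← Real.rpow_add hr]; congr 1; ring
  have e3 : ‖x‖ ^ (s - 2) = ‖x‖ ^ (s - 4) * ∑ i, x i ^ 2 := by
    rw [sum_sq, ← Real.rpow_natCast, ← Real.rpow_add hr]; congr 1; push_cast; ring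
  refine hsum.trans_eq ?_
  simp only [pd_Vf β s p he h _ hx, Finset.sum_add_distrib]
  have f1 : ∑ i, s * ‖x‖ ^ (s - 2) * x i * gg p e (φ x) * pd i φ x
      = s * ‖x‖ ^ (s - 2) * gg p e (φ x) * ∑ i, x i * pd i φ x := by
    rw [Finset.mul_sum]; exact Finset.sum_congr rfl fun i _ => by ring
  have f2 : ∑ i, β * ‖x‖ ^ (s - 2) * x i * p * gg p e (φ x) * pd i φ x
      = β * ‖x‖ ^ (s - 2) * p * gg p e (φ x) * ∑ i, x i * pd i φ x := by
    rw [Finset.mul_sum]; exact Finset.sum_congr rfl fun i _ => by ring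
  have f3 : ∑ i, (s - δ + β * p) * ‖x‖ ^ (s - 2) * gg p e (φ x) * x i * pd i φ x
      = (s - δ + β * p) * ‖x‖ ^ (s - 2) * gg p e (φ x) * ∑ i, x i * pd i φ x := by
    rw [Finset.mul_sum]; exact Finset.sum_congr rfl fun i _ => by ring
  have f4 : ∑ i, (s - δ + β * p) ^ 2 / 4 * ‖x‖ ^ (s - 4) * RR p e (φ x) * x i ^ 2
      = (s - δ + β * p) ^ 2 / 4 * ‖x‖ ^ (s - 2) * RR p e (φ x) := by
    rw [← Finset.mul_sum, e3]; ring
  have f5 : ∑ i, β * (s - 2) * ‖x‖ ^ (s - 4) * x i ^ 2 * GG p e (φ x)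
      = β * (s - 2) * ‖x‖ ^ (s - 2) * GG p e (φ x) := by
    rw [← Finset.sum_mul, ← Finset.mul_sum, e3]; ring
  have f6 : ∑ i : Fin d, β * ‖x‖ ^ (s - 2) * GG p e (φ x)
      = d * (β * ‖x‖ ^ (s - 2) * GG p e (φ x)) := by simp
  have f7 : ∑ i, ‖x‖ ^ s * gg p e (φ x) * pd i (pd i φ) x
      = ‖x‖ ^ s * gg p e (φ x) * ∑ i, pd i (pd i φ) x := by rw [Finset.mul_sum]
  rw [f1, f2, f3, f4, f5, f6, f7]
  linear_combination (gg p e (φ x) * ∑ i, pd i (pd i φ) x) * e1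
    + (δ * gg p e (φ x) * ∑ i, x i * pd i φ x) * e2

lemma contAt_npow {d : ℕ} (m : ℝ) {x : EE d} (hx : x ≠ 0) :
    ContinuousAt (fun y : EE d => ‖y‖ ^ m) x := (hasFDerivAt_npow m hx).continuousAt

lemma contAt_Hop {d : ℕ} (δ : ℝ) {φ : EE d → ℝ} (h : ContDiff ℝ 2 φ) {x : EE d} (hx : x ≠ 0) :
    ContinuousAt (Hop δ φ) x := by
  have : Hop δ φ =ᶠ[𝓝 x] fun x => - ‖x‖ ^ δ * ∑ i, pd i (pd i φ) x
      - δ * ‖x‖ ^ (δ - 2) * ∑ i, x i * pd i φ x := by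
    filter_upwards [isOpen_compl_singleton.mem_nhds hx] with y hy
    exact Hop_eq δ hy (((h.fderiv_right (m := 1) (by norm_num)).differentiable (by norm_num)) y)
  refine ContinuousAt.congr ?_ this.symm
  have c1 : ∀ i, Continuous (pd i (pd i φ)) := fun i =>
    ((contDiff_pd h i).continuous_fderiv (by norm_num)).clm_apply continuous_const
  have c2 : ∀ i, Continuous (pd i φ) := fun i => (contDiff_pd h i).continuous
  refine ((contAt_npow δ hx).neg.mul (Continuous.continuousAt (by fun_prop))).sub
    ((continuousAt_const.mul (contAt_npow _ hx)).mul (Continuous.continuousAt (by fun_prop)))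

def Qf {d : ℕ} (β s δ p e : ℝ) (φ : EE d → ℝ) (x : EE d) : ℝ :=
  ‖x‖ ^ (s - δ) * (gg p e (φ x) * Hop δ φ x)
      - β * (d + s - 2) * (‖x‖ ^ (s - 2) * GG p e (φ x))
      + (s - δ + β * p) ^ 2 / 4 * (‖x‖ ^ (s - 2) * RR p e (φ x))

lemma Qf_zero {d : ℕ} (β s δ p e : ℝ) {φ : EE d → ℝ} {x : EE d} (hx : x ∉ tsupport φ) :
    Qf β s δ p e φ x = 0 := by
  simp [Qf, image_eq_zero_of_notMem_tsupport hx, gg, GG, RR]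

lemma cont_Qf {d : ℕ} (β s δ : ℝ) {p e : ℝ} (hp : 1 < p) (he : 0 < e) {φ : EE d → ℝ}
    (h : ContDiff ℝ 2 φ) (h0 : (0 : EE d) ∉ tsupport φ) : Continuous (Qf β s δ p e φ) := by
  refine glue_cont (isClosed_tsupport φ) h0 (fun x hx => Qf_zero _ _ _ _ _ hx) fun x hx => ?_
  have hc := h.continuous
  have c1 : Continuous fun x => gg p e (φ x) := (contDiff_gg p he).continuous.comp hc
  have c2 : Continuous fun x => GG p e (φ x) := (contDiff_GG p he).continuous.comp hc
  have c3 : Continuous fun x => RR p e (φ x) := (cont_RR hp he).comp hc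
  unfold Qf
  exact (((contAt_npow _ hx).mul (c1.continuousAt.mul (contAt_Hop δ h hx))).sub
    (continuousAt_const.mul ((contAt_npow _ hx).mul c2.continuousAt))).add
    (continuousAt_const.mul ((contAt_npow _ hx).mul c3.continuousAt))

lemma Vf_zero {d : ℕ} (β s p e : ℝ) {φ : EE d → ℝ} (i : Fin d) {x : EE d} (hx : x ∉ tsupport φ) :
    Vf β s p e φ i x = 0 := by
  simp [Vf, image_eq_zero_of_notMem_tsupport hx, gg, GG]

lemma contDiff_Vf {d : ℕ} (β s p : ℝ) {e : ℝ} (he : 0 < e) {φ : EE d → ℝ}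
    (h : ContDiff ℝ 2 φ) (h0 : (0 : EE d) ∉ tsupport φ) (i : Fin d) :
    ContDiff ℝ 1 (Vf β s p e φ i) := by
  rw [contDiff_iff_contDiffAt]
  intro x
  by_cases hx : x = 0
  · subst hx
    have : Vf β s p e φ i =ᶠ[𝓝 0] fun _ => 0 := by
      filter_upwards [(isClosed_tsupport φ).isOpen_compl.mem_nhds h0] with y hy
        using Vf_zero _ _ _ _ _ hy
    exact contDiffAt_const.congr_of_eventuallyEq this
  · have hn : ∀ m : ℝ, ContDiffAt ℝ 1 (fun y : EE d => ‖y‖ ^ m) x := fun m =>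
      (contDiffAt_norm ℝ hx).rpow_const_of_ne (by simpa using hx)
    have h1 : ContDiff ℝ 1 φ := h.of_le (by norm_num)
    have c1 : ContDiff ℝ 1 fun x => gg p e (φ x) :=
      ((contDiff_gg p he).of_le (by norm_num)).comp h1
    have c2 : ContDiff ℝ 1 fun x => GG p e (φ x) :=
      ((contDiff_GG p he).of_le (by norm_num)).comp h1
    have c3 : ContDiff ℝ 1 fun x : EE d => x i := by fun_prop
    exact ((hn s).mul (c1.contDiffAt.mul (contDiff_pd h i).contDiffAt)).add
      (contDiffAt_const.mul ((hn _).mul (c3.contDiffAt.mul c2.contDiffAt)))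

lemma int_Qf {d : ℕ} (β s δ : ℝ) {p e : ℝ} (hp : 1 < p) (he : 0 < e) {φ : EE d → ℝ}
    (h : ContDiff ℝ 2 φ) (hK : HasCompactSupport φ) (h0 : (0 : EE d) ∉ tsupport φ) :
    0 ≤ ∫ x, Qf β s δ p e φ x := by
  have hQ : Integrable (Qf β s δ p e φ) :=
    glue_int hK (fun x hx => Qf_zero _ _ _ _ _ hx) (cont_Qf β s δ hp he h h0)
  have hV := fun i => int_pd_zero hK i (fun x hx => Vf_zero β s p e i hx)
    (contDiff_Vf β s p he h h0 i)
  have hT : ∫ x, ∑ i, pd i (Vf β s p e φ i) x = 0 := by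
    rw [integral_finsetSum _ fun i _ => (hV i).1]
    exact Finset.sum_eq_zero fun i _ => (hV i).2
  have hTi : Integrable fun x => ∑ i, pd i (Vf β s p e φ i) x :=
    integrable_finsetSum _ fun i _ => (hV i).1
  have : 0 ≤ ∫ x, (∑ i, pd i (Vf β s p e φ i) x + Qf β s δ p e φ x) := by
    refine integral_nonneg fun x => ?_
    by_cases hx : x = 0
    · subst hx
      have hs : ∀ i, tsupport (Vf β s p e φ i) ⊆ tsupport φ := fun i =>
        closure_minimal (fun x hx => by
          by_contra h'; exact hx (Vf_zero _ _ _ _ _ h')) (isClosed_tsupport φ)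
      simp only [Qf_zero _ _ _ _ _ h0]
      rw [Finset.sum_eq_zero fun i _ => pd_zero_of fun h' => h0 (hs i h')]
      simp
    · exact pointwise_ineq hp he β s δ h hx
  rwa [integral_add hTi hQ, hT, zero_add] at this
lemma tend_gg (p t : ℝ) : ContinuousAt (fun e => gg p e t) 0 := by
  by_cases ht : t = 0
  · subst ht; simp [gg, continuousAt_const]
  · unfold gg
    refine continuousAt_const.mul (ContinuousAt.rpow_const (by fun_prop) (Or.inl ?_))
    simpa using ht

lemma tend_GG {p : ℝ} (hp : 1 < p) (t : ℝ) : ContinuousAt (fun e => GG p e t) 0 := by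
  unfold GG
  exact (ContinuousAt.rpow_const (by fun_prop) (Or.inr (by positivity))).sub
    (ContinuousAt.rpow_const (by fun_prop) (Or.inr (by positivity)))

lemma tend_RR {p : ℝ} (hp : 1 < p) (t : ℝ) : ContinuousAt (fun e => RR p e t) 0 := by
  by_cases ht : t = 0
  · subst ht; simp [RR, continuousAt_const]
  · unfold RR
    refine (continuousAt_const.mul (ContinuousAt.rpow_const (by fun_prop) (Or.inl ?_))).div
      (by fun_prop) ?_
    · simpa using ht
    · have : p - 1 ≠ 0 := by linarith
      simpa using ⟨this, ht⟩

lemma bd_gg {p e : ℝ} (hp : 1 < p) (he : 0 < e) (he1 : e ≤ 1) (t : ℝ) :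
    |gg p e t| ≤ (t ^ 2 + 1) ^ ((p - 1) / 2) := by
  have hu : 0 < t ^ 2 + e := by positivity
  unfold gg
  rw [abs_mul, abs_of_pos (Real.rpow_pos_of_pos hu _)]
  have h1 : |t| ≤ (t ^ 2 + e) ^ ((1:ℝ) / 2) := by
    rw [← Real.sqrt_eq_rpow]
    exact Real.abs_le_sqrt (by linarith)
  calc |t| * (t ^ 2 + e) ^ (p / 2 - 1) ≤ (t ^ 2 + e) ^ ((1:ℝ) / 2) * (t ^ 2 + e) ^ (p / 2 - 1) := by
        gcongr
    _ = (t ^ 2 + e) ^ ((p - 1) / 2) := by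
        rw [← Real.rpow_add hu]; congr 1; ring
    _ ≤ _ := Real.rpow_le_rpow hu.le (by linarith) (by linarith)

lemma bd_GG {p e : ℝ} (hp : 1 < p) (he : 0 < e) (he1 : e ≤ 1) (t : ℝ) :
    |GG p e t| ≤ (t ^ 2 + 1) ^ (p / 2) := by
  have hu : 0 < t ^ 2 + e := by positivity
  unfold GG
  have h1 : e ^ (p / 2) ≤ (t ^ 2 + e) ^ (p / 2) :=
    Real.rpow_le_rpow he.le (by nlinarith) (by linarith)
  have h2 : (t ^ 2 + e) ^ (p / 2) ≤ (t ^ 2 + 1) ^ (p / 2) :=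
    Real.rpow_le_rpow hu.le (by linarith) (by linarith)
  have h3 : 0 < e ^ (p / 2) := Real.rpow_pos_of_pos he _
  rw [abs_of_nonneg (by linarith)]
  linarith

lemma bd_RR {p e : ℝ} (hp : 1 < p) (he : 0 < e) (he1 : e ≤ 1) (t : ℝ) :
    |RR p e t| ≤ (t ^ 2 + 1) ^ (p / 2) / (p - 1) := by
  have hu : 0 < t ^ 2 + e := by positivity
  have hp1 : 0 < p - 1 := by linarith
  have hA : 0 < (p - 1) * t ^ 2 + e := by positivity
  have h2 : (t ^ 2 + e) ^ (p / 2) ≤ (t ^ 2 + 1) ^ (p / 2) :=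
    Real.rpow_le_rpow hu.le (by linarith) (by linarith)
  have h3 : 0 < (t ^ 2 + e) ^ (p / 2) := Real.rpow_pos_of_pos hu _
  unfold RR
  rw [abs_of_nonneg (by positivity), div_le_div_iff₀ hA hp1]
  nlinarith [mul_le_mul_of_nonneg_left h2 (by positivity : 0 ≤ (p - 1) * t ^ 2),
    mul_pos (h3.trans_le h2) he]

lemma int_Q0 {d : ℕ} (β s δ : ℝ) {p : ℝ} (hp : 1 < p) {φ : EE d → ℝ}
    (h : ContDiff ℝ 2 φ) (hK : HasCompactSupport φ) (h0 : (0 : EE d) ∉ tsupport φ) :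
    Integrable (Qf β s δ p 0 φ) ∧ 0 ≤ ∫ x, Qf β s δ p 0 φ x := by
  set ε : ℕ → ℝ := fun n => 1 / ((n : ℝ) + 1) with hε
  have hεp : ∀ n, 0 < ε n := fun n => by positivity
  have hε1 : ∀ n, ε n ≤ 1 := fun n => by
    simp only [hε]; rw [div_le_one (by positivity)]; linarith [(Nat.cast_nonneg n : (0:ℝ) ≤ n)]
  have hεt : Tendsto ε atTop (𝓝 0) := tendsto_one_div_add_atTop_nhds_zero_nat
  set B : EE d → ℝ := (tsupport φ).indicator (fun x =>
    ‖x‖ ^ (s - δ) * ((φ x ^ 2 + 1) ^ ((p - 1) / 2) * |Hop δ φ x|)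
      + |β * (d + s - 2)| * (‖x‖ ^ (s - 2) * (φ x ^ 2 + 1) ^ (p / 2))
      + (s - δ + β * p) ^ 2 / 4 * (‖x‖ ^ (s - 2) * ((φ x ^ 2 + 1) ^ (p / 2) / (p - 1)))) with hB
  have hc := h.continuous
  have hBi : Integrable B := by
    rw [hB, integrable_indicator_iff (isClosed_tsupport φ).measurableSet]
    refine ContinuousOn.integrableOn_compact hK ?_
    intro x hx
    have hx0 : x ≠ 0 := fun h => h0 (h ▸ hx)
    apply ContinuousAt.continuousWithinAt
    have c : ∀ m : ℝ, ContinuousAt (fun x => (φ x ^ 2 + 1) ^ m) x := fun m =>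
      ContinuousAt.rpow_const (by fun_prop) (Or.inl (by positivity))
    exact (((contAt_npow _ hx0).mul ((c _).mul (contAt_Hop δ h hx0).abs)).add
      (continuousAt_const.mul ((contAt_npow _ hx0).mul (c _)))).add
      (continuousAt_const.mul ((contAt_npow _ hx0).mul ((c _).div_const _)))
  have hbd : ∀ n x, ‖Qf β s δ p (ε n) φ x‖ ≤ B x := by
    intro n x
    by_cases hx : x ∈ tsupport φ
    · rw [hB, Set.indicator_of_mem hx, Qf, Real.norm_eq_abs]
      have hr : ∀ m : ℝ, 0 ≤ ‖x‖ ^ m := fun m => Real.rpow_nonneg (norm_nonneg x) m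
      refine (abs_add_le _ _).trans (add_le_add ((abs_sub _ _).trans (add_le_add ?_ ?_)) ?_)
      · rw [abs_mul, abs_mul, abs_of_nonneg (hr _)]
        gcongr
        exact bd_gg hp (hεp n) (hε1 n) _
      · rw [abs_mul, abs_mul (‖x‖ ^ (s-2)), abs_of_nonneg (hr _)]
        gcongr
        exact bd_GG hp (hεp n) (hε1 n) _
      · rw [abs_mul, abs_mul (‖x‖ ^ (s-2)), abs_of_nonneg (hr _), abs_of_nonneg (by positivity : 0 ≤ (s - δ + β * p) ^ 2 / 4)]
        gcongr
        exact bd_RR hp (hεp n) (hε1 n) _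
    · rw [Qf_zero _ _ _ _ _ hx, hB, Set.indicator_of_notMem hx]; simp
  have hlim : ∀ x, Tendsto (fun n => Qf β s δ p (ε n) φ x) atTop (𝓝 (Qf β s δ p 0 φ x)) := by
    intro x
    have hcA : ContinuousAt (fun e => Qf β s δ p e φ x) 0 := by
      unfold Qf
      exact ((continuousAt_const.mul ((tend_gg p _).mul continuousAt_const)).sub
        (continuousAt_const.mul (continuousAt_const.mul (tend_GG hp _)))).add
        (continuousAt_const.mul (continuousAt_const.mul (tend_RR hp _)))
    exact hcA.tendsto.comp hεt
  have hm : ∀ n, AEStronglyMeasurable (Qf β s δ p (ε n) φ) volume := fun n =>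
    (cont_Qf β s δ hp (hεp n) h h0).aestronglyMeasurable
  constructor
  · refine hBi.mono' (aestronglyMeasurable_of_tendsto_ae atTop hm (ae_of_all _ hlim))
      (ae_of_all _ fun x => ?_)
    exact le_of_tendsto (hlim x).norm (Eventually.of_forall fun n => hbd n x)
  · have := tendsto_integral_of_dominated_convergence B hm hBi
      (fun n => ae_of_all _ (hbd n)) (ae_of_all _ hlim)
    exact ge_of_tendsto this (Eventually.of_forall fun n => int_Qf β s δ hp (hεp n) h hK h0)

lemma sq_rpow (t m : ℝ) : (t ^ 2) ^ (m / 2) = |t| ^ m := by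
  rw [← sq_abs, ← Real.rpow_natCast, ← Real.rpow_mul (abs_nonneg t)]
  congr 1; push_cast; ring

lemma abs_gg0 {p : ℝ} (hp : 1 < p) (t : ℝ) : |gg p 0 t| = |t| ^ (p - 1) := by
  by_cases ht : t = 0
  · subst ht
    rw [abs_zero, Real.zero_rpow (by linarith)]; simp [gg]
  · have : p / 2 - 1 = (p - 2) / 2 := by ring
    unfold gg
    rw [add_zero, this, sq_rpow, abs_mul, abs_of_nonneg (Real.rpow_nonneg (abs_nonneg t) _),
      mul_comm, ← Real.rpow_add_one (abs_pos.mpr ht).ne']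
    congr 1; ring

lemma GG0 {p : ℝ} (hp : 1 < p) (t : ℝ) : GG p 0 t = |t| ^ p := by
  unfold GG
  rw [add_zero, sq_rpow, Real.zero_rpow (by positivity), sub_zero]

lemma RR0 {p : ℝ} (hp : 1 < p) (t : ℝ) : RR p 0 t = |t| ^ p / (p - 1) := by
  unfold RR
  by_cases ht : t = 0
  · subst ht
    rw [abs_zero, Real.zero_rpow (by linarith)]; simp
  · have : p - 1 ≠ 0 := by linarith
    rw [add_zero, add_zero, sq_rpow]
    field_simp

lemma young' {p C a r f δ : ℝ} (hp : 1 < p) (hC : 0 < C) (ha : 0 ≤ a) (hr : 0 < r) (hf : 0 ≤ f) :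
    C ^ (p - 1) * (r ^ ((δ - 2) * (p - 1)) * (f ^ (p - 1) * a)) ≤
      a ^ p / p + (1 - 1 / p) * (C ^ p * (r ^ ((δ - 2) * p) * f ^ p)) := by
  have hpq : p.HolderConjugate (Real.conjExponent p) := Real.HolderConjugate.conjExponent hp
  have hr' : 0 ≤ r ^ (δ - 2) := Real.rpow_nonneg hr.le _
  set b := C * (r ^ (δ - 2) * f) with hb
  have hb0 : 0 ≤ b := by positivity
  have := Real.young_inequality_of_nonneg ha (Real.rpow_nonneg hb0 (p - 1)) hpq
  have e1 : (b ^ (p - 1)) ^ (Real.conjExponent p) = b ^ p := by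
    rw [← Real.rpow_mul hb0]; congr 1; unfold Real.conjExponent
    have : p - 1 ≠ 0 := by linarith
    field_simp
  have e2 : ∀ m : ℝ, b ^ m = C ^ m * (r ^ ((δ - 2) * m) * f ^ m) := fun m => by
    rw [hb, Real.mul_rpow hC.le (by positivity), Real.mul_rpow hr' hf, ← Real.rpow_mul hr.le]
  have e3 : (1 : ℝ) / Real.conjExponent p = 1 - 1 / p := by
    unfold Real.conjExponent
    have : p - 1 ≠ 0 := by linarith
    field_simp
  rw [e1, div_eq_mul_one_div (b ^ p), e3, e2, e2] at this
  linarith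

lemma lower_bound {d : ℕ} (hd : 1 ≤ d) {p δ : ℝ} (hp : 1 < p)
    (hcond : 0 < (d : ℝ) + p * δ - 2 * p) {φ : EE d → ℝ}
    (h : ContDiff ℝ 2 φ) (hK : HasCompactSupport φ) (h0 : (0 : EE d) ∉ tsupport φ) :
    ((p - 1) * (d : ℝ) * ((d : ℝ) + p * δ - 2 * p) / p ^ 2) ^ p *
      (∫ x, ‖x‖ ^ ((δ - 2) * p) * |φ x| ^ p) ≤ ∫ x, |Hop δ φ x| ^ p := by
  have hd' : (0:ℝ) < d := by exact_mod_cast hd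
  have hp1 : 0 < p - 1 := by linarith
  have hp0 : 0 < p := by linarith
  set N := (d : ℝ) + p * δ - 2 * p with hN
  set C := (p - 1) * (d : ℝ) * N / p ^ 2 with hCdef
  have hC : 0 < C := by positivity
  set b := (2 - δ) * (p - 1) with hb
  set κ := 2 * (p - 1) * N / p with hκ
  set β := (b + κ) / p with hβ
  set s := δ - b with hs
  have hsδ : s - δ = (δ - 2) * (p - 1) := by rw [hs, hb]; ring
  have hs2 : s - 2 = (δ - 2) * p := by rw [hs, hb]; ring
  have hκ' : s - δ + β * p = κ := by rw [hs, hβ]; field_simp; ring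
  have hN' : (d : ℝ) + s - 2 = N := by rw [add_sub_assoc, hs2, hN]; ring
  obtain ⟨hQi, hQ⟩ := int_Q0 β s δ hp h hK h0
  have hA : Integrable fun x => |Hop δ φ x| ^ p := by
    have hz : ∀ x, x ∉ tsupport φ → |Hop δ φ x| ^ p = 0 := fun x hx => by
      rw [Hop_zero_of h hx, abs_zero, Real.zero_rpow hp0.ne']
    refine glue_int hK hz (glue_cont (isClosed_tsupport φ) h0 hz fun x hx => ?_)
    exact (contAt_Hop δ h hx).abs.rpow_const (Or.inr hp0.le)
  have hD : Integrable fun x => ‖x‖ ^ ((δ - 2) * p) * |φ x| ^ p := by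
    have hz : ∀ x, x ∉ tsupport φ → ‖x‖ ^ ((δ - 2) * p) * |φ x| ^ p = 0 := fun x hx => by
      rw [image_eq_zero_of_notMem_tsupport hx, abs_zero, Real.zero_rpow hp0.ne', mul_zero]
    refine glue_int hK hz (glue_cont (isClosed_tsupport φ) h0 hz fun x hx => ?_)
    exact (contAt_npow _ hx).mul (h.continuous.continuousAt.abs.rpow_const (Or.inr hp0.le))
  have hpt : ∀ x, C ^ (p - 1) * Qf β s δ p 0 φ x ≤
      |Hop δ φ x| ^ p / p - C ^ p / p * (‖x‖ ^ ((δ - 2) * p) * |φ x| ^ p) := by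
    intro x
    by_cases hx : x = 0
    · subst hx
      rw [Qf_zero _ _ _ _ _ h0, Hop_zero_of h h0, image_eq_zero_of_notMem_tsupport h0, abs_zero,
        Real.zero_rpow hp0.ne']
      simp
    · have hr : 0 < ‖x‖ := norm_pos_iff.mpr hx
      have hy := young' (δ := δ) hp hC (abs_nonneg (Hop δ φ x)) hr (abs_nonneg (φ x))
      have hCp : C ^ p = C ^ (p - 1) * C := by
        rw [← Real.rpow_add_one hC.ne']; congr 1; ring
      have hCp0 : 0 < C ^ (p - 1) := Real.rpow_pos_of_pos hC _
      have h1 : gg p 0 (φ x) * Hop δ φ x ≤ |φ x| ^ (p - 1) * |Hop δ φ x| := by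
        rw [← abs_gg0 hp, ← abs_mul]; exact le_abs_self _
      have h2 := mul_le_mul_of_nonneg_left (mul_le_mul_of_nonneg_left h1
        (Real.rpow_nonneg hr.le ((δ - 2) * (p - 1)))) hCp0.le
      have h3 : β * N - κ ^ 2 / 4 / (p - 1) = C := by
        rw [hβ, hκ, hCdef, hb, hN]; field_simp; ring
      unfold Qf
      rw [hκ', hN', hsδ, hs2, GG0 hp, RR0 hp]
      have h4 : C ^ (p - 1) * (‖x‖ ^ ((δ - 2) * (p - 1)) * (gg p 0 (φ x) * Hop δ φ x)
          - β * N * (‖x‖ ^ ((δ - 2) * p) * |φ x| ^ p)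
          + κ ^ 2 / 4 * (‖x‖ ^ ((δ - 2) * p) * (|φ x| ^ p / (p - 1))))
          = C ^ (p - 1) * (‖x‖ ^ ((δ - 2) * (p - 1)) * (gg p 0 (φ x) * Hop δ φ x))
            - C ^ p * (‖x‖ ^ ((δ - 2) * p) * |φ x| ^ p) := by
        rw [hCp]
        linear_combination (- C ^ (p - 1) * (‖x‖ ^ ((δ - 2) * p) * |φ x| ^ p)) * h3
      rw [h4]
      have h5 : (1 - 1 / p) * (C ^ p * (‖x‖ ^ ((δ - 2) * p) * |φ x| ^ p)) =
        C ^ p * (‖x‖ ^ ((δ - 2) * p) * |φ x| ^ p)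
          - C ^ p / p * (‖x‖ ^ ((δ - 2) * p) * |φ x| ^ p) := by ring
      linarith
  have hmono := integral_mono (hQi.const_mul _) ((hA.div_const p).sub (hD.const_mul (C ^ p / p)))
    hpt
  simp only [Pi.sub_apply] at hmono
  rw [integral_const_mul, integral_sub (hA.div_const p) (hD.const_mul _), integral_const_mul,
    integral_div] at hmono
  have hCp0 : 0 < C ^ (p - 1) := Real.rpow_pos_of_pos hC _
  have h6 := (mul_nonneg hCp0.le hQ).trans hmono
  rw [div_mul_eq_mul_div, ← sub_div] at h6
  have := (div_nonneg_iff.mp h6).resolve_right (by rintro ⟨_, h⟩; linarith)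
  linarith [this.1]
lemma hasFDerivAt_lognorm {d : ℕ} {x : EE d} (hx : x ≠ 0) :
    HasFDerivAt (fun y : EE d => Real.log ‖y‖) ((‖x‖ ^ (-2 : ℝ)) • innerSL ℝ x) x := by
  have hr : 0 < ‖x‖ := norm_pos_iff.mpr hx
  have h1 := hasFDerivAt_npow 1 hx
  simp only [Real.rpow_one] at h1
  have h2 := h1.log hr.ne'
  refine h2.congr_fderiv ?_
  rw [smul_smul]
  congr 1
  rw [one_mul, show (1:ℝ) - 2 = -1 by norm_num, Real.rpow_neg_one, ← mul_inv, ← pow_two,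
    Real.rpow_neg hr.le, Real.rpow_two]

lemma Hop_radial {d : ℕ} (δ : ℝ) {φ : EE d → ℝ} (h : ContDiff ℝ 2 φ) {q q1 q2 : ℝ → ℝ}
    (hq : ∀ t, HasDerivAt q (q1 t) t) (hq1 : ∀ t, HasDerivAt q1 (q2 t) t)
    (hφ : ∀ y, y ≠ 0 → φ y = q (Real.log ‖y‖)) {x : EE d} (hx : x ≠ 0) :
    Hop δ φ x = - ‖x‖ ^ (δ - 2) * (q2 (Real.log ‖x‖) + (d + δ - 2) * q1 (Real.log ‖x‖)) := by
  have hr : 0 < ‖x‖ := norm_pos_iff.mpr hx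
  have hpd : ∀ i, ∀ y : EE d, y ≠ 0 → pd i φ y = q1 (Real.log ‖y‖) * (‖y‖ ^ (-2 : ℝ) * y i) := by
    intro i y hy
    have he : φ =ᶠ[𝓝 y] fun z => q (Real.log ‖z‖) := by
      filter_upwards [isOpen_compl_singleton.mem_nhds hy] with z hz using hφ z hz
    have h1 := (hq (Real.log ‖y‖)).comp_hasFDerivAt y (hasFDerivAt_lognorm hy)
    unfold pd
    rw [(h1.congr_of_eventuallyEq he).fderiv]
    simp only [_root_.smul_apply, smul_eq_mul, innerSL_apply_apply, inner_single']
  have hpp : ∀ i, pd i (pd i φ) x = q2 (Real.log ‖x‖) * ‖x‖ ^ (-4 : ℝ) * x i ^ 2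
      + q1 (Real.log ‖x‖) * ‖x‖ ^ (-2 : ℝ) - 2 * q1 (Real.log ‖x‖) * ‖x‖ ^ (-4 : ℝ) * x i ^ 2 := by
    intro i
    have he : pd i φ =ᶠ[𝓝 x] fun y => q1 (Real.log ‖y‖) * (‖y‖ ^ (-2 : ℝ) * y i) := by
      filter_upwards [isOpen_compl_singleton.mem_nhds hx] with z hz using hpd i z hz
    have h1 := (hq1 (Real.log ‖x‖)).comp_hasFDerivAt x (hasFDerivAt_lognorm hx)
    have hxi : HasFDerivAt (fun y : EE d => y i) (EuclideanSpace.proj (𝕜 := ℝ) i) x :=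
      (EuclideanSpace.proj (𝕜 := ℝ) i).hasFDerivAt
    have h2 := h1.mul ((hasFDerivAt_npow (-2) hx).mul hxi)
    have h3 : HasFDerivAt (pd i φ) _ x := h2.congr_of_eventuallyEq he
    have hp1 : EuclideanSpace.proj (𝕜 := ℝ) i (EuclideanSpace.single i (1 : ℝ)) = (1 : ℝ) := by simp
    have e4 : ‖x‖ ^ (-4 : ℝ) = ‖x‖ ^ (-2 : ℝ) * ‖x‖ ^ (-2 : ℝ) := by
      rw [← Real.rpow_add hr]; norm_num
    rw [pd, h3.fderiv]
    simp only [_root_.add_apply, _root_.smul_apply, smul_eq_mul, innerSL_apply_apply, inner_single',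
      Function.comp, hp1, Pi.mul_apply]
    rw [show (-2 : ℝ) - 2 = -4 by norm_num, e4]
    ring
  rw [Hop_eq δ hx (((h.fderiv_right (m := 1) (by norm_num)).differentiable (by norm_num)) x)]
  have e2 : ‖x‖ ^ (-4 : ℝ) * ∑ i, x i ^ 2 = ‖x‖ ^ (-2 : ℝ) := by
    rw [sum_sq, ← Real.rpow_natCast, ← Real.rpow_add hr]; congr 1; norm_num
  have e3 : ‖x‖ ^ (-2 : ℝ) * ∑ i, x i ^ 2 = 1 := by
    rw [sum_sq, ← Real.rpow_natCast, ← Real.rpow_add hr]; norm_num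
  have s1 : ∑ i, x i * pd i φ x = q1 (Real.log ‖x‖) := by
    rw [← mul_one (q1 (Real.log ‖x‖)), ← e3, Finset.mul_sum, Finset.mul_sum]
    refine Finset.sum_congr rfl fun i _ => ?_
    rw [hpd i x hx]; ring
  have s2 : ∑ i, pd i (pd i φ) x = ‖x‖ ^ (-2 : ℝ) *
      (q2 (Real.log ‖x‖) + (d - 2) * q1 (Real.log ‖x‖)) := by
    simp only [hpp, Finset.sum_sub_distrib, Finset.sum_add_distrib, ← Finset.mul_sum]
    rw [mul_assoc, e2, mul_assoc _ (‖x‖ ^ (-4 : ℝ)), e2]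
    simp
    ring
  have e5 : ‖x‖ ^ δ * ‖x‖ ^ (-2 : ℝ) = ‖x‖ ^ (δ - 2) := by rw [← Real.rpow_add hr]; congr 1
  rw [s1, s2, ← e5]
  ring

lemma cov {ε : ℝ} (hε : 0 < ε) (f : ℝ → ℝ) :
    ∫ y in Ioi (0:ℝ), y⁻¹ * f (ε * Real.log y) = ε⁻¹ * ∫ t, f t := by
  have himg : (fun t => Real.exp (t / ε)) '' univ = Ioi (0:ℝ) := by
    ext y
    simp only [image_univ, mem_range, mem_Ioi]
    constructor
    · rintro ⟨t, rfl⟩; exact Real.exp_pos _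
    · intro hy
      exact ⟨ε * Real.log y, by rw [mul_div_cancel_left₀ _ hε.ne', Real.exp_log hy]⟩
  have := integral_image_eq_integral_abs_deriv_smul (s := univ)
    (f := fun t => Real.exp (t / ε)) (f' := fun t => Real.exp (t / ε) * (1 / ε)) MeasurableSet.univ
    (fun t _ => (((hasDerivAt_id t).div_const ε).exp).hasDerivWithinAt)
    (fun t _ u _ htu => by
      have := Real.exp_injective htu
      field_simp at this; exact this) (fun y => y⁻¹ * f (ε * Real.log y))
  rw [himg] at this
  rw [this, setIntegral_univ, ← integral_const_mul]
  refine integral_congr_ae (ae_of_all _ fun t => ?_)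
  have hp := Real.exp_pos (t / ε)
  simp only [smul_eq_mul, Real.log_exp]
  rw [abs_of_pos (by positivity), mul_div_cancel₀ _ hε.ne']
  field_simp

lemma radial_int {d : ℕ} (hd : 1 ≤ d) : ∃ c : ℝ, 0 < c ∧ ∀ ε : ℝ, 0 < ε → ∀ f : ℝ → ℝ,
    ∫ x in ({0}ᶜ : Set (EE d)), ‖x‖ ^ (-(d : ℝ)) * f (ε * Real.log ‖x‖) = c * ε⁻¹ * ∫ t, f t := by
  have : Nonempty (Fin d) := ⟨⟨0, hd⟩⟩
  have : Nontrivial (EE d) := inferInstance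
  have hd' : (0:ℝ) < d := by exact_mod_cast hd
  refine ⟨d * (volume : Measure (EE d)).real (Metric.ball 0 1), mul_pos hd' ?_, ?_⟩
  · exact ENNReal.toReal_pos (Metric.measure_ball_pos _ _ one_pos).ne' measure_ball_lt_top.ne
  · intro ε hε f
    rw [restrict_compl_singleton,
      integral_fun_norm_addHaar volume (fun r => r ^ (-(d : ℝ)) * f (ε * Real.log r))]
    have hdim : Module.finrank ℝ (EE d) = d := by simp
    rw [hdim, nsmul_eq_mul, smul_eq_mul, mul_assoc, mul_assoc, ← cov hε f]
    congr 2
    refine setIntegral_congr_fun measurableSet_Ioi fun y hy => ?_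
    have hy : 0 < y := hy
    simp only [smul_eq_mul]
    rw [← mul_assoc]
    congr 1
    rw [← Real.rpow_natCast, ← Real.rpow_add hy, ← Real.rpow_neg_one]
    congr 1
    rw [Nat.cast_sub hd]; push_cast; ring

lemma upper_bound {d : ℕ} (hd : 1 ≤ d) {p δ : ℝ} (hp : 1 < p)
    (hcond : 0 < (d : ℝ) + p * δ - 2 * p) :
    ∃ J : ℝ → ℝ, Tendsto J (𝓝[>] 0)
      (𝓝 (((p - 1) * (d : ℝ) * ((d : ℝ) + p * δ - 2 * p) / p ^ 2) ^ p)) ∧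
      ∀ ε : ℝ, 0 < ε → ∃ φ : EE d → ℝ, ContDiff ℝ 2 φ ∧ HasCompactSupport φ ∧
        tsupport φ ⊆ ({0}ᶜ : Set (EE d)) ∧ φ ≠ 0 ∧
        J ε = (∫ x in ({0}ᶜ : Set (EE d)), |Hop δ φ x| ^ p) /
            (∫ x in ({0}ᶜ : Set (EE d)), ‖x‖ ^ ((δ - 2) * p) * |φ x| ^ p) := by
  have hd' : (0:ℝ) < d := by exact_mod_cast hd
  have hp1 : 0 < p - 1 := by linarith
  have hp0 : 0 < p := by linarith
  set N := (d : ℝ) + p * δ - 2 * p with hN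
  set C := (p - 1) * (d : ℝ) * N / p ^ 2 with hCdef
  have hC : 0 < C := by positivity
  set a := N / p with ha
  have ha0 : 0 < a := by positivity
  set m := (d : ℝ) + δ - 2 with hm
  have hCa : C = a * m - a ^ 2 := by rw [hCdef, ha, hm, hN]; field_simp; ring
  let bump : ContDiffBump (0:ℝ) := ⟨1, 2, one_pos, one_lt_two⟩
  set χ : ℝ → ℝ := fun t => bump t with hχ
  have hχs : ContDiff ℝ 3 χ := bump.contDiff
  have hχ0 : χ 0 = 1 := bump.one_of_mem_closedBall (by simp [bump])
  have hχz : ∀ t, 2 ≤ |t| → χ t = 0 := fun t ht =>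
    bump.zero_of_le_dist (by simpa [bump] using ht)
  have hχc : HasCompactSupport χ := bump.hasCompactSupport
  set χ1 := deriv χ with hχ1
  set χ2 := deriv χ1 with hχ2
  have hχ1s : ContDiff ℝ 2 χ1 := ((contDiff_succ_iff_deriv (n := 2)).mp (by exact_mod_cast hχs)).2.2
  have hχ2s : ContDiff ℝ 1 χ2 := ((contDiff_succ_iff_deriv (n := 1)).mp (by exact_mod_cast hχ1s)).2.2
  have hχd : ∀ t, HasDerivAt χ (χ1 t) t := fun t =>
    (hχs.differentiable (by norm_num) t).hasDerivAt
  have hχ1d : ∀ t, HasDerivAt χ1 (χ2 t) t := fun t =>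
    (hχ1s.differentiable (by norm_num) t).hasDerivAt
  set W : ℝ → ℝ → ℝ := fun ε t => C * χ t - ε * (m - 2 * a) * χ1 t - ε ^ 2 * χ2 t with hW
  have hDpos : 0 < ∫ t, |χ t| ^ p := by
    have hcont : Continuous fun t => |χ t| ^ p :=
      hχs.continuous.abs.rpow_const fun _ => Or.inr hp0.le
    refine hcont.integral_pos_of_hasCompactSupport_nonneg_nonzero (x := 0) ?_ ?_ ?_
    · exact hχc.comp_left (g := fun s => |s| ^ p) (by simp [hp0.ne'])
    · exact fun t => Real.rpow_nonneg (abs_nonneg _) _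
    · simp [hχ0]
  refine ⟨fun ε => (∫ t, |W ε t| ^ p) / ∫ t, |χ t| ^ p, ?_, ?_⟩
  · have hWz : ∀ ε, ∀ t, t ∉ tsupport χ → |W ε t| ^ p = 0 := by
      intro ε t ht
      have h1 : χ1 t = 0 := by
        by_contra h; exact ht (support_deriv_subset h)
      have h2 : χ2 t = 0 := by
        by_contra h
        have h3 : t ∈ tsupport χ1 := support_deriv_subset h
        exact ht (closure_minimal support_deriv_subset (isClosed_tsupport χ) h3)
      simp [hW, h1, h2, image_eq_zero_of_notMem_tsupport ht, hp0.ne']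
    have hWK : ∀ ε, ∫ t, |W ε t| ^ p = ∫ t in tsupport χ, |W ε t| ^ p := fun ε =>
      (setIntegral_eq_integral_of_forall_compl_eq_zero (hWz ε)).symm
    have hcont : Continuous fun ε => ∫ t in tsupport χ, |W ε t| ^ p := by
      refine continuous_parametric_integral_of_continuous ?_ hχc
      have c0 := hχs.continuous
      have c1 := hχ1s.continuous
      have c2 := hχ2s.continuous
      have : Continuous fun z : ℝ × ℝ => W z.1 z.2 := by simp only [hW]; fun_prop
      exact this.abs.rpow_const fun _ => Or.inr hp0.le
    have hT := (hcont.tendsto 0).mono_left (nhdsWithin_le_nhds (s := Ioi (0:ℝ)))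
    simp only [← hWK] at hT
    have h0 : ∫ t, |W 0 t| ^ p = C ^ p * ∫ t, |χ t| ^ p := by
      rw [← integral_const_mul]
      refine integral_congr_ae (ae_of_all _ fun t => ?_)
      simp only [hW]
      rw [← Real.mul_rpow hC.le (abs_nonneg _), ← abs_of_pos hC, ← abs_mul, abs_of_pos hC]
      congr 2; ring
    have := hT.div_const (∫ t, |χ t| ^ p)
    rwa [h0, mul_div_cancel_right₀ _ hDpos.ne'] at this
  · intro ε hε
    set φ : EE d → ℝ := fun x => ‖x‖ ^ (-a) * χ (ε * Real.log ‖x‖) with hφ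
    set K : Set (EE d) := {x | Real.exp (-2 / ε) ≤ ‖x‖} ∩ Metric.closedBall 0 (Real.exp (2 / ε))
      with hKdef
    have hKc : IsCompact K := (isCompact_closedBall _ _).inter_left
      (isClosed_le continuous_const continuous_norm)
    have hz : ∀ x, x ∉ K → φ x = 0 := by
      intro x hx
      by_cases hx0 : x = 0
      · subst hx0; simp [hφ, Real.zero_rpow (neg_ne_zero.mpr ha0.ne')]
      have hr : 0 < ‖x‖ := norm_pos_iff.mpr hx0
      simp only [hφ]
      rw [hχz, mul_zero]
      by_contra hlt
      push Not at hlt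
      rw [abs_lt] at hlt
      apply hx
      constructor
      · show Real.exp (-2 / ε) ≤ ‖x‖
        rw [← Real.le_log_iff_exp_le hr, div_le_iff₀ hε]; linarith [hlt.1]
      · rw [mem_closedBall_zero_iff, ← Real.log_le_iff_le_exp hr, le_div_iff₀ hε]; linarith [hlt.2]
    have hts : tsupport φ ⊆ K := closure_minimal (fun x hx => by
      by_contra h; exact hx (hz x h)) hKc.isClosed
    have h0K : (0 : EE d) ∉ K := by
      rintro ⟨h, -⟩
      have : Real.exp (-2 / ε) ≤ ‖(0 : EE d)‖ := h
      rw [norm_zero] at this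
      exact absurd (Real.exp_pos (-2 / ε)) (not_lt.mpr this)
    have hsm : ContDiff ℝ 2 φ := by
      rw [contDiff_iff_contDiffAt]
      intro x
      by_cases hx : x = 0
      · subst hx
        have : φ =ᶠ[𝓝 0] fun _ => 0 := by
          filter_upwards [hKc.isClosed.isOpen_compl.mem_nhds h0K] with y hy using hz y hy
        exact contDiffAt_const.congr_of_eventuallyEq this
      · have hn : ContDiffAt ℝ 2 (fun y : EE d => ‖y‖) x := contDiffAt_norm ℝ hx
        have hne : ‖x‖ ≠ 0 := by simpa using hx
        exact (hn.rpow_const_of_ne hne).mul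
          ((hχs.of_le (by norm_num)).contDiffAt.comp x (contDiffAt_const.mul (hn.log hne)))
    refine ⟨φ, hsm, HasCompactSupport.intro hKc hz, fun x hx h => h0K (h ▸ hts hx), ?_, ?_⟩
    · intro h
      have := congrFun h (EuclideanSpace.single ⟨0, hd⟩ (1:ℝ))
      simp [hφ, hχ0] at this
    · obtain ⟨c, hc, hci⟩ := radial_int hd
      set q : ℝ → ℝ := fun t => Real.exp (-a * t) * χ (ε * t) with hq
      set q1 : ℝ → ℝ := fun t => Real.exp (-a * t) * (-a * χ (ε * t) + ε * χ1 (ε * t)) with hq1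
      set q2 : ℝ → ℝ := fun t => Real.exp (-a * t) *
        (a ^ 2 * χ (ε * t) - 2 * a * ε * χ1 (ε * t) + ε ^ 2 * χ2 (ε * t)) with hq2
      have hlin : ∀ (b t : ℝ), HasDerivAt (fun t : ℝ => b * t) b t := fun b t => by
        simpa using (hasDerivAt_id t).const_mul b
      have hexp : ∀ t, HasDerivAt (fun t => Real.exp (-a * t)) (Real.exp (-a * t) * (-a)) t :=
        fun t => (hlin (-a) t).exp
      have hcχ : ∀ t, HasDerivAt (fun t => χ (ε * t)) (χ1 (ε * t) * ε) t := fun t =>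
        (hχd (ε * t)).comp t (hlin ε t)
      have hcχ1 : ∀ t, HasDerivAt (fun t => χ1 (ε * t)) (χ2 (ε * t) * ε) t := fun t =>
        (hχ1d (ε * t)).comp t (hlin ε t)
      have hqd : ∀ t, HasDerivAt q (q1 t) t := fun t =>
        ((hexp t).mul (hcχ t)).congr_deriv (by simp only [hq1]; ring)
      have hq1d : ∀ t, HasDerivAt q1 (q2 t) t := fun t =>
        ((hexp t).mul (((hcχ t).const_mul (-a)).add ((hcχ1 t).const_mul ε))).congr_deriv
          (by simp only [hq2, Pi.add_apply]; ring)
      have hra : ∀ x : EE d, x ≠ 0 → Real.exp (-a * Real.log ‖x‖) = ‖x‖ ^ (-a) := fun x hx => by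
        rw [Real.rpow_def_of_pos (norm_pos_iff.mpr hx)]; congr 1; ring
      have hap : (δ - 2) * p + -a * p = -(d : ℝ) := by rw [ha, hN]; field_simp; ring
      have hnum : ∀ x ∈ ({0}ᶜ : Set (EE d)), |Hop δ φ x| ^ p =
          ‖x‖ ^ (-(d : ℝ)) * (fun t => |W ε t| ^ p) (ε * Real.log ‖x‖) := by
        intro x hx
        have hx : x ≠ 0 := hx
        have hr : 0 < ‖x‖ := norm_pos_iff.mpr hx
        rw [Hop_radial δ hsm hqd hq1d (fun y hy => by simp only [hq, hφ, hra y hy]) hx]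
        have : - ‖x‖ ^ (δ - 2) * (q2 (Real.log ‖x‖) + (d + δ - 2) * q1 (Real.log ‖x‖))
            = ‖x‖ ^ (δ - 2) * ‖x‖ ^ (-a) * W ε (ε * Real.log ‖x‖) := by
          simp only [hq1, hq2, hW, hra x hx, hCa, hm]; ring
        rw [this, abs_mul, ← Real.rpow_add hr, abs_of_pos (Real.rpow_pos_of_pos hr _),
          Real.mul_rpow (Real.rpow_nonneg hr.le _) (abs_nonneg _), ← Real.rpow_mul hr.le, add_mul,
          hap]
      have hden : ∀ x ∈ ({0}ᶜ : Set (EE d)), ‖x‖ ^ ((δ - 2) * p) * |φ x| ^ p =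
          ‖x‖ ^ (-(d : ℝ)) * (fun t => |χ t| ^ p) (ε * Real.log ‖x‖) := by
        intro x hx
        have hx : x ≠ 0 := hx
        have hr : 0 < ‖x‖ := norm_pos_iff.mpr hx
        simp only [hφ]
        rw [abs_mul, abs_of_pos (Real.rpow_pos_of_pos hr _),
          Real.mul_rpow (Real.rpow_nonneg hr.le _) (abs_nonneg _), ← Real.rpow_mul hr.le,
          ← mul_assoc, ← Real.rpow_add hr, hap]
      have hms : MeasurableSet ({0}ᶜ : Set (EE d)) := (measurableSet_singleton _).compl
      have hn := (setIntegral_congr_fun (μ := volume) hms hnum).trans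
        (hci ε hε (fun t => |W ε t| ^ p))
      have hdd := (setIntegral_congr_fun (μ := volume) hms hden).trans
        (hci ε hε (fun t => |χ t| ^ p))
      rw [hn, hdd, mul_div_mul_left _ _ (by positivity)]

/-- Optimality of the Rellich constant on `ℝ^d \ {0}` with weight `|x|^δ`
(Proposition 4.7 of the paper). -/
theorem rellich_optimal_constant_punctured
    (d : ℕ) (hd : 1 ≤ d)
    (p δ : ℝ) (hp : 1 < p) (hδ0 : 0 ≤ δ) (hδ2 : δ < 2)
    (hcond : 0 < (d : ℝ) + p * δ - 2 * p) :
    sInf { r : ℝ | ∃ φ : EuclideanSpace ℝ (Fin d) → ℝ,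
        ContDiff ℝ 2 φ ∧ HasCompactSupport φ ∧
        tsupport φ ⊆ ({0}ᶜ : Set (EuclideanSpace ℝ (Fin d))) ∧ φ ≠ 0 ∧
        r = (∫ x in ({0}ᶜ : Set (EuclideanSpace ℝ (Fin d))), |Hop δ φ x| ^ p) /
            (∫ x in ({0}ᶜ : Set (EuclideanSpace ℝ (Fin d))),
              ‖x‖ ^ ((δ - 2) * p) * |φ x| ^ p) }
      = ((p - 1) * (d : ℝ) * ((d : ℝ) + p * δ - 2 * p) / p ^ 2) ^ p := by
  have hp0 : 0 < p := by linarith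
  obtain ⟨J, hJ, hJφ⟩ := upper_bound hd hp hcond
  have hlow : ∀ r ∈ { r : ℝ | ∃ φ : EuclideanSpace ℝ (Fin d) → ℝ,
        ContDiff ℝ 2 φ ∧ HasCompactSupport φ ∧
        tsupport φ ⊆ ({0}ᶜ : Set (EuclideanSpace ℝ (Fin d))) ∧ φ ≠ 0 ∧
        r = (∫ x in ({0}ᶜ : Set (EuclideanSpace ℝ (Fin d))), |Hop δ φ x| ^ p) /
            (∫ x in ({0}ᶜ : Set (EuclideanSpace ℝ (Fin d))),
              ‖x‖ ^ ((δ - 2) * p) * |φ x| ^ p) },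
      ((p - 1) * (d : ℝ) * ((d : ℝ) + p * δ - 2 * p) / p ^ 2) ^ p ≤ r := by
    rintro r ⟨φ, h, hK, hts, hne, rfl⟩
    have h0 : (0 : EE d) ∉ tsupport φ := fun hx => hts hx rfl
    have hz1 : ∀ x : EE d, x ∉ ({0}ᶜ : Set (EE d)) → |Hop δ φ x| ^ p = 0 := fun x hx => by
      have : x = 0 := by simpa using hx
      rw [this, Hop_zero_of h h0, abs_zero, Real.zero_rpow hp0.ne']
    have hz2' : ∀ x, x ∉ tsupport φ → ‖x‖ ^ ((δ - 2) * p) * |φ x| ^ p = 0 := fun x hx => by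
      rw [image_eq_zero_of_notMem_tsupport hx, abs_zero, Real.zero_rpow hp0.ne', mul_zero]
    have hz2 : ∀ x : EE d, x ∉ ({0}ᶜ : Set (EE d)) → ‖x‖ ^ ((δ - 2) * p) * |φ x| ^ p = 0 :=
      fun x hx => hz2' x (by
        have : x = 0 := by simpa using hx
        exact this ▸ h0)
    rw [setIntegral_eq_integral_of_forall_compl_eq_zero hz1,
      setIntegral_eq_integral_of_forall_compl_eq_zero hz2]
    have hcont : Continuous fun x : EE d => ‖x‖ ^ ((δ - 2) * p) * |φ x| ^ p := by
      refine glue_cont (isClosed_tsupport φ) h0 hz2' fun x hx => ?_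
      exact (contAt_npow _ hx).mul (h.continuous.continuousAt.abs.rpow_const (Or.inr hp0.le))
    obtain ⟨x, hx⟩ : ∃ x, φ x ≠ 0 := by
      by_contra hcon; push Not at hcon; exact hne (funext hcon)
    have hx0 : x ≠ 0 := fun hx' => hx (by
      rw [hx']; exact image_eq_zero_of_notMem_tsupport h0)
    have hpos : 0 < ∫ x : EE d, ‖x‖ ^ ((δ - 2) * p) * |φ x| ^ p := by
      refine hcont.integral_pos_of_hasCompactSupport_nonneg_nonzero (x := x)
        (HasCompactSupport.intro hK hz2') (fun y => ?_) ?_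
      · exact mul_nonneg (Real.rpow_nonneg (norm_nonneg _) _) (Real.rpow_nonneg (abs_nonneg _) _)
      · exact (mul_pos (Real.rpow_pos_of_pos (norm_pos_iff.mpr hx0) _)
          (Real.rpow_pos_of_pos (abs_pos.mpr hx) _)).ne'
    rw [le_div_iff₀ hpos]
    exact lower_bound hd hp hcond h hK h0
  refine le_antisymm ?_ (le_csInf ⟨J 1, hJφ 1 one_pos⟩ hlow)
  refine ge_of_tendsto hJ ?_
  filter_upwards [self_mem_nhdsWithin] with ε hε
  exact csInf_le ⟨_, hlow⟩ (hJφ ε hε)
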